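/- Let ρ₁ > 0 and α ∈ (3, 4). Let u : [ρ₁, ∞) → ℝ be twice continuously differentiable and suppose there is a constant C₀ such that |u(ρ)| ≤ C₀ ρ^(−1/2) and |u'(ρ)| ≤ C₀ ρ^(−3/2) for all ρ ≥ ρ₁. Then ((α − 1)² (α − 3)²/16) · ∫_{ρ₁}^∞ ρ^(α−4) u(ρ)² dρ ≤ ∫_{ρ₁}^∞ ρ^α u''(ρ)² dρ, where both sides are Lebesgue integrals with values in [0, ∞]. -/

import Mathlib

open Set MeasureTheory Filter Topology

/-- The Hardy inequality on `[a, R]` with weight `x ^ β`, including the boundary term at `R`. -/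
theorem hardy_intervalIntegral_le {a β R : ℝ} (ha : 0 < a) (hβ : 1 ≤ β) (hR : a ≤ R)
    {f f' : ℝ → ℝ} (hf : ∀ t ∈ Ici a, HasDerivWithinAt f (f' t) (Ici a) t)
    (hf' : ContinuousOn f' (Ici a)) :
    ((β - 1) / 2) ^ 2 * ∫ x in a..R, x ^ (β - 2) * f x ^ 2
      ≤ (∫ x in a..R, x ^ β * f' x ^ 2) + (β - 1) / 2 * (R ^ (β - 1) * f R ^ 2) := by
  have hIcc : Icc a R ⊆ Ici a := Icc_subset_Ici_self
  have hfc : ContinuousOn f (Icc a R) := fun t ht =>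
    ((hf t (hIcc ht)).continuousWithinAt).mono hIcc
  have hf'c : ContinuousOn f' (Icc a R) := hf'.mono hIcc
  have hpow (p : ℝ) : ContinuousOn (fun x : ℝ => x ^ p) (Icc a R) := fun x hx =>
    (Real.continuousAt_rpow_const x p (Or.inl (ha.trans_le hx.1).ne')).continuousWithinAt
  have hint {g : ℝ → ℝ} (hg : ContinuousOn g (Icc a R)) : IntervalIntegrable g volume a R :=
    ContinuousOn.intervalIntegrable_of_Icc hR hg
  have hA : IntervalIntegrable (fun x => x ^ (β - 2) * f x ^ 2) volume a R :=
    hint ((hpow (β - 2)).mul (hfc.pow 2))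
  have hB : IntervalIntegrable (fun x => x ^ β * f' x ^ 2) volume a R :=
    hint ((hpow β).mul (hf'c.pow 2))
  have hD : IntervalIntegrable
      (fun x => (β - 1) * x ^ (β - 2) * f x ^ 2 + x ^ (β - 1) * (2 * f x * f' x)) volume a R :=
    hint (((continuousOn_const.mul (hpow (β - 2))).mul (hfc.pow 2)).add
      ((hpow (β - 1)).mul ((continuousOn_const.mul hfc).mul hf'c)))
  have hftc : ∫ x in a..R,
      ((β - 1) * x ^ (β - 2) * f x ^ 2 + x ^ (β - 1) * (2 * f x * f' x))
      = R ^ (β - 1) * f R ^ 2 - a ^ (β - 1) * f a ^ 2 := by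
    refine intervalIntegral.integral_eq_sub_of_hasDerivAt_of_le hR
      ((hpow (β - 1)).mul (hfc.pow 2)) (fun x hx => ?_) hD
    have hfx : HasDerivAt f (f' x) x := (hf x hx.1.le).hasDerivAt (Ici_mem_nhds hx.1)
    have hx0 : x ≠ 0 := (ha.trans hx.1).ne'
    refine ((Real.hasDerivAt_rpow_const (p := β - 1) (Or.inl hx0)).mul
      (hfx.pow 2)).congr_deriv ?_
    rw [show β - 1 - 1 = β - 2 by ring]
    simp
  have hmono : ∫ x in a..R, ((β - 1) / 2) ^ 2 * (x ^ (β - 2) * f x ^ 2)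
      ≤ ∫ x in a..R, (x ^ β * f' x ^ 2 + (β - 1) / 2 *
        ((β - 1) * x ^ (β - 2) * f x ^ 2 + x ^ (β - 1) * (2 * f x * f' x))) := by
    refine intervalIntegral.integral_mono_on hR (hA.const_mul _) (hB.add (hD.const_mul _))
      fun x hx => ?_
    have hx0 : 0 < x := ha.trans_le hx.1
    have h1 : x ^ (β - 1) = x ^ (β - 2) * x := by
      rw [← Real.rpow_add_one hx0.ne']; ring_nf
    have h2 : x ^ β = x ^ (β - 2) * x * x := by
      rw [← h1, ← Real.rpow_add_one hx0.ne']; ring_nf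
    have h0 : 0 ≤ x ^ (β - 2) * (x * f' x + (β - 1) / 2 * f x) ^ 2 := by positivity
    rw [h1, h2]
    linarith
  rw [intervalIntegral.integral_const_mul,
    intervalIntegral.integral_add hB (hD.const_mul _),
    intervalIntegral.integral_const_mul, hftc] at hmono
  have hpos : 0 ≤ (β - 1) / 2 * (a ^ (β - 1) * f a ^ 2) :=
    mul_nonneg (by linarith) (by positivity)
  linarith

/-- The Hardy inequality on `[a, ∞)` with weight `x ^ β`, for functions decaying at infinity. -/
theorem hardy_lintegral_Ici_le {a β : ℝ} (ha : 0 < a) (hβ : 1 ≤ β)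
    {f f' : ℝ → ℝ} (hf : ∀ t ∈ Ici a, HasDerivWithinAt f (f' t) (Ici a) t)
    (hf' : ContinuousOn f' (Ici a))
    (hlim : Tendsto (fun x => x ^ (β - 1) * f x ^ 2) atTop (𝓝 0)) :
    ENNReal.ofReal (((β - 1) / 2) ^ 2) * ∫⁻ x in Ici a, ENNReal.ofReal (x ^ (β - 2) * f x ^ 2)
      ≤ ∫⁻ x in Ici a, ENNReal.ofReal (x ^ β * f' x ^ 2) := by
  have hfc : ContinuousOn f (Ici a) := fun t ht => (hf t ht).continuousWithinAt
  have hcont (p : ℝ) {g : ℝ → ℝ} (hg : ContinuousOn g (Ici a)) :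
      ContinuousOn (fun x => x ^ p * g x ^ 2) (Ici a) :=
    ContinuousOn.mul (fun x hx => (Real.continuousAt_rpow_const x p
      (Or.inl (ha.trans_le hx).ne')).continuousWithinAt) (hg.pow 2)
  have hofReal (p : ℝ) {g : ℝ → ℝ} (hg : ContinuousOn g (Ici a)) {R : ℝ} (hR : a ≤ R) :
      ∫⁻ x in Iic R, ENNReal.ofReal (x ^ p * g x ^ 2) ∂(volume.restrict (Ici a))
        = ENNReal.ofReal (∫ x in a..R, x ^ p * g x ^ 2) := by
    rw [Measure.restrict_restrict measurableSet_Iic, inter_comm, Ici_inter_Iic,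
      intervalIntegral.integral_of_le hR, ← integral_Icc_eq_integral_Ioc,
      ofReal_integral_eq_lintegral_ofReal
        ((hcont p hg).mono Icc_subset_Ici_self).integrableOn_Icc]
    filter_upwards [ae_restrict_mem measurableSet_Icc] with x hx
    have hx0 : 0 < x := ha.trans_le hx.1
    positivity
  have htend (p : ℝ) {g : ℝ → ℝ} (hg : ContinuousOn g (Ici a)) :=
    (aecover_Iic (μ := volume.restrict (Ici a))
      (tendsto_id (α := ℝ) (x := atTop))).lintegral_tendsto_of_countably_generated
      ((hcont p hg).aemeasurable measurableSet_Ici).ennreal_ofReal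
  have hbdry : Tendsto (fun x => ENNReal.ofReal ((β - 1) / 2 * (x ^ (β - 1) * f x ^ 2)))
      atTop (𝓝 0) := by
    simpa using ENNReal.tendsto_ofReal (hlim.const_mul ((β - 1) / 2))
  have hright := (htend β hf').add hbdry
  rw [add_zero] at hright
  refine le_of_tendsto_of_tendsto
    (ENNReal.Tendsto.const_mul (htend (β - 2) hfc) (Or.inr ENNReal.ofReal_ne_top)) hright ?_
  filter_upwards [eventually_ge_atTop a] with R hR
  simp only [id]
  rw [hofReal _ hfc hR, hofReal _ hf' hR, ← ENNReal.ofReal_mul (sq_nonneg _)]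
  exact (ENNReal.ofReal_le_ofReal (hardy_intervalIntegral_le ha hβ hR hf hf')).trans
    ENNReal.ofReal_add_le

theorem tendsto_rpow_mul_sq_zero_of_abs_le {a C p q : ℝ} {f : ℝ → ℝ}
    (hf : ∀ x ∈ Ici a, |f x| ≤ C * x ^ q) (hpq : p + 2 * q < 0) :
    Tendsto (fun x => x ^ p * f x ^ 2) atTop (𝓝 0) := by
  have hlim : Tendsto (fun x : ℝ => C ^ 2 * x ^ (-(-(p + 2 * q)))) atTop (𝓝 0) := by
    simpa using (tendsto_rpow_neg_atTop (neg_pos.mpr hpq)).const_mul (C ^ 2)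
  refine tendsto_of_tendsto_of_tendsto_of_le_of_le' tendsto_const_nhds hlim ?_ ?_
  · filter_upwards [eventually_gt_atTop 0] with x hx
    positivity
  · filter_upwards [eventually_gt_atTop 0, eventually_ge_atTop a] with x hx hxa
    have hsq : f x ^ 2 ≤ (C * x ^ q) ^ 2 := by
      rw [← sq_abs]
      exact pow_le_pow_left₀ (abs_nonneg _) (hf x hxa) 2
    calc x ^ p * f x ^ 2 ≤ x ^ p * (C * x ^ q) ^ 2 := by gcongr
      _ = C ^ 2 * x ^ (-(-(p + 2 * q))) := by
        rw [neg_neg, two_mul, Real.rpow_add hx, Real.rpow_add hx]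
        ring

/-- For ρ₁ > 0, α ∈ (3,4), and u twice continuously differentiable on [ρ₁, ∞)
with |u(ρ)| ≤ C₀ ρ^(−1/2) and |u'(ρ)| ≤ C₀ ρ^(−3/2),
((α − 1)²(α − 3)²/16) ∫_{ρ₁}^∞ ρ^(α−4) u² ≤ ∫_{ρ₁}^∞ ρ^α (u'')² (Lebesgue integrals in [0,∞]). -/
theorem stmt_2 (ρ₁ α : ℝ) (hρ₁ : 0 < ρ₁) (hα : α ∈ Ioo (3 : ℝ) 4)
    (u u' u'' : ℝ → ℝ) (C₀ : ℝ)
    (hu : ∀ t ∈ Ici ρ₁, HasDerivWithinAt u (u' t) (Ici ρ₁) t)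
    (hu' : ∀ t ∈ Ici ρ₁, HasDerivWithinAt u' (u'' t) (Ici ρ₁) t)
    (hu''cont : ContinuousOn u'' (Ici ρ₁))
    (hbound : ∀ ρ ∈ Ici ρ₁, |u ρ| ≤ C₀ * ρ ^ (-(1/2) : ℝ))
    (hbound' : ∀ ρ ∈ Ici ρ₁, |u' ρ| ≤ C₀ * ρ ^ (-(3/2) : ℝ)) :
    ENNReal.ofReal ((α - 1) ^ 2 * (α - 3) ^ 2 / 16) *
        ∫⁻ ρ in Ici ρ₁, ENNReal.ofReal (ρ ^ (α - 4) * u ρ ^ 2)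
      ≤ ∫⁻ ρ in Ici ρ₁, ENNReal.ofReal (ρ ^ α * u'' ρ ^ 2) := by
  obtain ⟨h3, h4⟩ := hα
  have hcont' : ContinuousOn u' (Ici ρ₁) := fun t ht => (hu' t ht).continuousWithinAt
  have hfirst := hardy_lintegral_Ici_le hρ₁ (by linarith : 1 ≤ α - 2) hu hcont'
    (tendsto_rpow_mul_sq_zero_of_abs_le hbound (by linarith))
  have hsecond := hardy_lintegral_Ici_le hρ₁ (by linarith : 1 ≤ α) hu' hu''cont
    (tendsto_rpow_mul_sq_zero_of_abs_le hbound' (by linarith))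
  rw [show α - 2 - 2 = α - 4 by ring] at hfirst
  refine le_trans ?_ ((mul_le_mul_right hfirst _).trans hsecond)
  rw [← mul_assoc, ← ENNReal.ofReal_mul (sq_nonneg _)]
  refine le_of_eq ?_
  congr 2
  ring
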